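/- Let F_M ∈ ℂ^{M×M}, A ∈ ℂ^{M×N}, F_N ∈ ℂ^{N×N}, W̄ ∈ ℂ^{N×N̄}, b ∈ ℂ^{N̄}, and η ∈ ℂ^{N}. Then F_M · A · F_N^H · diag(W̄ b) · η = (η^T ⊗ I_M) · ((W̄ ∗ F_N^*) ⊗ F_M) · vec(b^T ⊗ A), where both sides are vectors in ℂ^M. -/

import Mathlib

open Matrix

noncomputable section

/-- Kronecker product with 0-based flattened indices:
`(A ⊗ B)[(i)p+k, (j)q+l] = A i j * B k l`. -/
def kron {m n p q : ℕ} (A : Matrix (Fin m) (Fin n) ℂ) (B : Matrix (Fin p) (Fin q) ℂ) :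
    Matrix (Fin (m * p)) (Fin (n * q)) ℂ :=
  Matrix.of fun i j =>
    A (finProdFinEquiv.symm i).1 (finProdFinEquiv.symm j).1 *
      B (finProdFinEquiv.symm i).2 (finProdFinEquiv.symm j).2

/-- Column-stacking vectorization: `vec(A)[(j)r + i] = A i j`. -/
def vec {r c : ℕ} (A : Matrix (Fin r) (Fin c) ℂ) : Fin (c * r) → ℂ :=
  fun i => A (finProdFinEquiv.symm i).2 (finProdFinEquiv.symm i).1

/-- Row-wise Khatri–Rao product: `(A ∗ B)[i, (j)p + k] = A i j * B i k`. -/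
def rowKR {m n p : ℕ} (A : Matrix (Fin m) (Fin n) ℂ) (B : Matrix (Fin m) (Fin p) ℂ) :
    Matrix (Fin m) (Fin (n * p)) ℂ :=
  Matrix.of fun i j =>
    A i (finProdFinEquiv.symm j).1 * B i (finProdFinEquiv.symm j).2

/-- Column-wise Khatri–Rao product: `(A • B)[(i)p + k, j] = A i j * B k j`. -/
def colKR {m p s : ℕ} (A : Matrix (Fin m) (Fin s) ℂ) (B : Matrix (Fin p) (Fin s) ℂ) :
    Matrix (Fin (m * p)) (Fin s) ℂ :=
  Matrix.of fun i j =>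
    A (finProdFinEquiv.symm i).1 j * B (finProdFinEquiv.symm i).2 j

/-- A vector regarded as a `1 × n` row matrix (the transpose of a column vector). -/
def rowVec {n : ℕ} (v : Fin n → ℂ) : Matrix (Fin 1) (Fin n) ℂ :=
  Matrix.of fun _ j => v j

end

theorem sum_finProdFinEquiv {n q : ℕ} (f : Fin (n * q) → ℂ) :
    ∑ x, f x = ∑ j, ∑ l, f (finProdFinEquiv (j, l)) := by
  rw [← finProdFinEquiv.sum_comp, Fintype.sum_prod_type]

theorem kron_mulVec_apply {m n p q : ℕ} (A : Matrix (Fin m) (Fin n) ℂ)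
    (B : Matrix (Fin p) (Fin q) ℂ) (v : Fin (n * q) → ℂ) (i : Fin m) (k : Fin p) :
    (kron A B).mulVec v (finProdFinEquiv (i, k)) =
      ∑ j, ∑ l, A i j * B k l * v (finProdFinEquiv (j, l)) := by
  simp only [Matrix.mulVec, dotProduct, sum_finProdFinEquiv, kron, Matrix.of_apply,
    Equiv.symm_apply_apply]

theorem cast_eq_finProdFinEquiv {M : ℕ} (h : M = 1 * M) (i : Fin M) :
    Fin.cast h i = finProdFinEquiv ((0 : Fin 1), i) := by
  ext
  simp

theorem vec_kron_rowVec_apply {M N Nb : ℕ} (b : Fin Nb → ℂ) (A : Matrix (Fin M) (Fin N) ℂ)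
    (h : Nb * N * M = Nb * N * (1 * M)) (k : Fin Nb) (n : Fin N) (m : Fin M) :
    vec (kron (rowVec b) A) (Fin.cast h (finProdFinEquiv (finProdFinEquiv (k, n), m))) =
      b k * A m n := by
  have hcast : Fin.cast h (finProdFinEquiv (finProdFinEquiv (k, n), m)) =
      finProdFinEquiv (finProdFinEquiv (k, n), finProdFinEquiv ((0 : Fin 1), m)) := by
    ext
    simp
  rw [hcast]
  simp only [_root_.vec, kron, rowVec, Matrix.of_apply, Equiv.symm_apply_apply]

/-- `F_M A F_N^H diag(W̄ b) η = (η^T ⊗ I_M)((W̄ ∗ F_N^*) ⊗ F_M) vec(b^T ⊗ A)`. -/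
theorem cascaded_channel_bilinear_form {M N Nb : ℕ}
    (F_M : Matrix (Fin M) (Fin M) ℂ) (A : Matrix (Fin M) (Fin N) ℂ)
    (F_N : Matrix (Fin N) (Fin N) ℂ) (W : Matrix (Fin N) (Fin Nb) ℂ)
    (b : Fin Nb → ℂ) (η : Fin N → ℂ) :
    ∀ i : Fin M,
      (F_M * A * F_N.conjTranspose * Matrix.diagonal (W.mulVec b)).mulVec η i
        = (kron (rowVec η) (1 : Matrix (Fin M) (Fin M) ℂ) *
              kron (rowKR W (F_N.map star)) F_M).mulVec
            (fun j => vec (kron (rowVec b) A) (Fin.cast (by ring) j))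
            (Fin.cast (by ring) i) := by
  intro i
  rw [← Matrix.mulVec_mulVec _ (kron _ _), cast_eq_finProdFinEquiv, kron_mulVec_apply]
  simp only [kron_mulVec_apply, sum_finProdFinEquiv, vec_kron_rowVec_apply]
  simp only [rowKR, rowVec,
    Matrix.of_apply, Equiv.symm_apply_apply, Matrix.one_apply, mul_ite, ite_mul, mul_one,
    mul_zero, zero_mul, Finset.sum_ite_eq, Finset.mem_univ, if_true, Matrix.map_apply]
  simp only [Matrix.mulVec, dotProduct, Matrix.mul_diagonal]
  refine Finset.sum_congr rfl fun n _ => ?_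
  simp only [Matrix.mul_apply, Matrix.conjTranspose_apply, Finset.sum_mul, Finset.mul_sum]
  refine Finset.sum_congr rfl fun k _ => Finset.sum_congr rfl fun n' _ =>
    Finset.sum_congr rfl fun m _ => ?_
  ring
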